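/- arXiv:1702.05996 — 4 statements merged into one kernel-verified Lean document; each statement's English description precedes it below -/
import Mathlib

section
/- Suppose L_0 and L_1 are linear operators preserving both B_s and B_w, and f_0, f_1 ∈ B_s are probability measures fixed by L_0 and L_1 respectively. Assume: (1) there is a continuous function φ : ℝ → ℝ decreasing to 0 at infinity such that ||L_0^n g||_w ≤ φ(n) ||g||_s for every n and every g ∈ V_s (convergence to equilibrium with speed φ); (2) there is M̃ ≥ 0 with max(||f_0||_s, ||f_1||_s) ≤ M̃; (3) there is C̃ ≥ 0 with ||L_0^n||_{B_w→B_w} ≤ C̃ for every n; (4) set ε := sup_{||f||_s ≤ 1} ||(L_1 − L_0) f||_w. Then, letting ψ be the decreasing function ψ(x) = φ(x)/x, it holds ||f_1 − f_0||_w ≤ 2 M̃ C̃ ε ( ψ^{-1}( ε C̃ / 2 ) + 1 ). -/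
open MeasureTheory Set Filter

/-- Telescoping estimate: if the seminorm `p` of `L ^ k (L f - f)` is at most `c` for every `k`,
then `L ^ n f` is at distance at most `n * c` from `f`. -/
lemma seminorm_sub_iterate_le {V : Type*} [AddCommGroup V] [Module ℝ V] (p : V → ℝ)
    (p_zero : p 0 = 0) (p_add : ∀ f g, p (f + g) ≤ p f + p g) (L : V →ₗ[ℝ] V) (f : V) (c : ℝ)
    (hc : ∀ k : ℕ, p ((L ^ k) (f - L f)) ≤ c) (n : ℕ) :
    p (f - (L ^ n) f) ≤ n * c := by
  induction n with
  | zero => simp [p_zero]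
  | succ n ih =>
    have hsplit : f - (L ^ (n + 1)) f = (f - (L ^ n) f) + (L ^ n) (f - L f) := by
      rw [map_sub, pow_succ, Module.End.mul_apply]
      abel
    rw [hsplit]
    push_cast
    linarith [p_add (f - (L ^ n) f) ((L ^ n) (f - L f)), hc n]

/-- **Quantitative fixed point stability** (Theorem 2.3 of the paper).
`Bs ⊆ Bw` are normed subspaces of the signed measures on a metric space `X`
(with seminorms `ns`, `nw`, `nw ≤ ns` on `Bs`), preserved by the transfer operators
`L0`, `L1`, which fix the probability measures `f0`, `f1 ∈ Bs` respectively.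
Assume: (1) `L0` has convergence to equilibrium with speed `φ` (continuous, decreasing to `0`);
(2) `max (ns f0) (ns f1) ≤ Mt`; (3) the iterates of `L0` have weak norm bounded by `Ct`;
(4) `ε` is the supremum of `nw ((L1 - L0) f)` over the unit ball of `Bs`.
Then, with `ψ x = φ x / x` (decreasing, with inverse `ψinv`),
`nw (f1 - f0) ≤ 2 Mt Ct ε (ψ⁻¹(ε Ct / 2) + 1)`. -/
theorem statistical_stability_fixed_points
    {X : Type*} [MetricSpace X] [MeasurableSpace X]
    (Bs Bw : Submodule ℝ (MeasureTheory.SignedMeasure X)) (hBsw : Bs ≤ Bw)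
    (ns nw : MeasureTheory.SignedMeasure X → ℝ)
    -- `ns`, `nw` are (semi)norms
    (hns0 : ns 0 = 0) (hnsnonneg : ∀ f, 0 ≤ ns f)
    (hnsadd : ∀ f g, ns (f + g) ≤ ns f + ns g) (hnssmul : ∀ (c : ℝ) f, ns (c • f) = |c| * ns f)
    (hnw0 : nw 0 = 0) (hnwnonneg : ∀ f, 0 ≤ nw f)
    (hnwadd : ∀ f g, nw (f + g) ≤ nw f + nw g) (hnwsmul : ∀ (c : ℝ) f, nw (c • f) = |c| * nw f)
    (hwlows : ∀ f ∈ Bs, nw f ≤ ns f)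
    -- the operators preserve the spaces
    (L0 L1 : MeasureTheory.SignedMeasure X →ₗ[ℝ] MeasureTheory.SignedMeasure X)
    (hL0s : ∀ f ∈ Bs, L0 f ∈ Bs) (hL0w : ∀ f ∈ Bw, L0 f ∈ Bw)
    (hL1s : ∀ f ∈ Bs, L1 f ∈ Bs) (hL1w : ∀ f ∈ Bw, L1 f ∈ Bw)
    -- `f0`, `f1` are fixed probability measures of `L0`, `L1` in `Bs`
    (f0 f1 : MeasureTheory.SignedMeasure X) (hf0s : f0 ∈ Bs) (hf1s : f1 ∈ Bs)
    (hf0pos : ∀ E : Set X, MeasurableSet E → 0 ≤ f0 E) (hf0prob : f0 Set.univ = 1)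
    (hf1pos : ∀ E : Set X, MeasurableSet E → 0 ≤ f1 E) (hf1prob : f1 Set.univ = 1)
    (hfix0 : L0 f0 = f0) (hfix1 : L1 f1 = f1)
    -- (1) speed of convergence to equilibrium
    (φ : ℝ → ℝ) (hφcont : Continuous φ) (hφdec : Antitone φ)
    (hφlim : Tendsto φ atTop (nhds 0))
    (hconv : ∀ n : ℕ, ∀ g ∈ Bs, g Set.univ = 0 → nw ((L0 ^ n) g) ≤ φ n * ns g)
    -- (2) control on the norms of the invariant measures
    (Mt : ℝ) (hMt : 0 ≤ Mt) (hMbound : max (ns f0) (ns f1) ≤ Mt)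
    -- (3) the iterates of the transfer operator are uniformly bounded in the weak norm
    (Ct : ℝ) (hCt : 0 ≤ Ct) (hCbound : ∀ n : ℕ, ∀ g ∈ Bw, nw ((L0 ^ n) g) ≤ Ct * nw g)
    -- (4) `ε` is the size of the perturbation in the strong-weak norm
    (ε : ℝ) (hε : IsLUB {x : ℝ | ∃ f ∈ Bs, ns f ≤ 1 ∧ x = nw (L1 f - L0 f)} ε)
    -- `ψ x = φ x / x` is decreasing, with inverse `ψinv`
    (hψdec : AntitoneOn (fun x => φ x / x) (Ioi (0:ℝ)))
    (ψinv : ℝ → ℝ) (hψinv : ∀ y : ℝ, 0 < y → 0 < ψinv y ∧ φ (ψinv y) / ψinv y = y) :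
    nw (f1 - f0) ≤ 2 * Mt * Ct * ε * (ψinv (ε * Ct / 2) + 1) := by
  have hns0le : ns f0 ≤ Mt := (le_max_left _ _).trans hMbound
  have hns1le : ns f1 ≤ Mt := (le_max_right _ _).trans hMbound
  have sub_le (p : SignedMeasure X → ℝ) (hadd : ∀ f g, p (f + g) ≤ p f + p g)
      (hsmul : ∀ (c : ℝ) f, p (c • f) = |c| * p f) (f g : SignedMeasure X) :
      p (f - g) ≤ p f + p g := by
    have hneg : p (-g) = p g := by
      have h := hsmul (-1) g
      rwa [neg_one_smul ℝ g, abs_neg, abs_one, one_mul] at h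
    simpa [sub_eq_add_neg, hneg] using hadd f (-g)
  rcases hMt.eq_or_lt with rfl | hMtpos
  · have h := sub_le nw hnwadd hnwsmul f1 f0
    have h0 := hwlows f0 hf0s
    have h1 := hwlows f1 hf1s
    simp only [mul_zero, zero_mul]
    linarith
  have hε0 : 0 ≤ ε := hε.1 ⟨0, Bs.zero_mem, by simp [hns0], by simp [hnw0]⟩
  have hpert : nw (f1 - L0 f1) ≤ Mt * ε := by
    have h : nw (Mt⁻¹ • (f1 - L0 f1)) ≤ ε := by
      refine hε.1 ⟨Mt⁻¹ • f1, Bs.smul_mem _ hf1s, ?_, ?_⟩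
      · rw [hnssmul, abs_of_pos (inv_pos.2 hMtpos)]
        exact (inv_mul_le_one₀ hMtpos).2 hns1le
      · rw [map_smul, map_smul, hfix1, smul_sub]
    rw [hnwsmul, abs_of_pos (inv_pos.2 hMtpos)] at h
    exact (inv_mul_le_iff₀ hMtpos).1 h
  have hbound (n : ℕ) (hn : 0 ≤ φ n) :
      nw (f1 - f0) ≤ 2 * Mt * φ n + n * (Ct * (Mt * ε)) := by
    have htel := seminorm_sub_iterate_le nw hnw0 hnwadd L0 f1 (Ct * (Mt * ε)) (fun k =>
      (hCbound k _ (hBsw (Bs.sub_mem hf1s (hL0s _ hf1s)))).trans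
        (mul_le_mul_of_nonneg_left hpert hCt)) n
    have hzero : (f1 - f0) Set.univ = 0 := by
      simp [hf0prob, hf1prob]
    have heq := hconv n (f1 - f0) (Bs.sub_mem hf1s hf0s) hzero
    have hs : ns (f1 - f0) ≤ 2 * Mt := by
      linarith [sub_le ns hnsadd hnssmul f1 f0]
    have hfix : (L0 ^ n) f0 = f0 := by
      rw [Module.End.pow_apply]
      exact Function.iterate_fixed hfix0 n
    have hsplit : f1 - f0 = (f1 - (L0 ^ n) f1) + (L0 ^ n) (f1 - f0) := by
      rw [map_sub, hfix]
      abel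
    calc nw (f1 - f0) = nw ((f1 - (L0 ^ n) f1) + (L0 ^ n) (f1 - f0)) := by rw [← hsplit]
      _ ≤ nw (f1 - (L0 ^ n) f1) + nw ((L0 ^ n) (f1 - f0)) := hnwadd _ _
      _ ≤ 2 * Mt * φ n + n * (Ct * (Mt * ε)) := by
        nlinarith [mul_le_mul_of_nonneg_left hs hn]
  have hφ0 (x : ℝ) : 0 ≤ φ x := hφdec.le_of_tendsto hφlim x
  rcases (mul_nonneg hε0 hCt).eq_or_lt with hzero | hpos
  · have hlim : Tendsto (fun n : ℕ => 2 * Mt * φ n) atTop (nhds (2 * Mt * 0)) :=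
      (hφlim.comp tendsto_natCast_atTop_atTop).const_mul _
    have hle : nw (f1 - f0) ≤ 2 * Mt * 0 := by
      refine ge_of_tendsto' hlim fun n => (hbound n (hφ0 n)).trans_eq ?_
      linear_combination (-(n * Mt : ℝ)) * hzero
    refine hle.trans_eq ?_
    linear_combination (2 * Mt * (ψinv (ε * Ct / 2) + 1)) * hzero
  · obtain ⟨hxpos, hx⟩ := hψinv (ε * Ct / 2) (half_pos hpos)
    set x := ψinv (ε * Ct / 2)
    rw [div_eq_iff hxpos.ne'] at hx
    have hceil : (⌈x⌉₊ : ℝ) ≤ x + 1 := (Nat.ceil_lt_add_one hxpos.le).le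
    have hφle : φ ⌈x⌉₊ ≤ ε * Ct / 2 * x := (hφdec (Nat.le_ceil x)).trans_eq hx
    calc nw (f1 - f0) ≤ 2 * Mt * φ ⌈x⌉₊ + ⌈x⌉₊ * (Ct * (Mt * ε)) := hbound _ (hφ0 _)
      _ ≤ 2 * Mt * (ε * Ct / 2 * x) + (x + 1) * (Ct * (Mt * ε)) := by gcongr
      _ ≤ 2 * Mt * Ct * ε * (x + 1) := by nlinarith [mul_pos hMtpos hpos]
end

section
/- Suppose L_0, L_1 are linear operators preserving B_s and B_w with fixed probability measures f_0, f_1 ∈ B_s, satisfying: ||L_0^n g||_w ≤ φ(n)||g||_s for all g ∈ V_s with φ(x) = C x^{-α} for some C > 0, α > 0; max(||f_0||_s, ||f_1||_s) ≤ M̃; ||L_0^n||_{B_w→B_w} ≤ C̃ for all n; and ε := sup_{||f||_s ≤ 1} ||(L_1 − L_0)f||_w. Then there is a constant K_1, depending only on M̃, C̃ and C (and not on ε), such that ||f_1 − f_0||_w ≤ K_1 ε^{1 − 1/(α+1)} = K_1 ε^{α/(α+1)}. -/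
open MeasureTheory Set Filter

/-- Optimising a bound `n a ε + b n^{-α}` over positive integers `n`. -/
theorem le_mul_rpow_of_forall_nat_le {a b d x ε α : ℝ} (ha : 0 ≤ a) (hb : 0 ≤ b) (hd : 0 ≤ d)
    (hα : 0 < α) (hε : 0 ≤ ε) (hx : x ≤ d)
    (h : ∀ n : ℕ, 0 < n → x ≤ n * (a * ε) + b * (n : ℝ) ^ (-α)) :
    x ≤ (2 * a + b + d) * ε ^ (1 - 1 / (α + 1)) := by
  have hα' : 0 < α + 1 := by linarith
  have hexp : 1 - 1 / (α + 1) = α / (α + 1) := by field_simp; ring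
  have hpos : 0 < α / (α + 1) := by positivity
  rcases hε.eq_or_lt with rfl | hε
  · rw [hexp, Real.zero_rpow hpos.ne', mul_zero]
    have hlim : Tendsto (fun n : ℕ => b * (n : ℝ) ^ (-α)) atTop (nhds (b * 0)) :=
      ((tendsto_rpow_neg_atTop hα).comp tendsto_natCast_atTop_atTop).const_mul b
    rw [mul_zero] at hlim
    refine ge_of_tendsto hlim ?_
    filter_upwards [eventually_gt_atTop 0] with n hn
    simpa using h n hn
  rcases le_total ε 1 with h1 | h1
  · set t : ℝ := ε ^ (-(1 / (α + 1))) with ht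
    have ht1 : 1 ≤ t :=
      Real.one_le_rpow_of_pos_of_le_one_of_nonpos hε h1 (by simp; positivity)
    have htpos : 0 < t := by linarith
    have hn : 0 < ⌈t⌉₊ := Nat.ceil_pos.mpr htpos
    have hle : t ≤ ⌈t⌉₊ := Nat.le_ceil t
    have hup : (⌈t⌉₊ : ℝ) ≤ 2 * t := by linarith [Nat.ceil_lt_add_one htpos.le]
    have htε : t * ε = ε ^ (1 - 1 / (α + 1)) := by
      rw [ht, sub_eq_neg_add, Real.rpow_add hε, Real.rpow_one]
    have htα : t ^ (-α) = ε ^ (1 - 1 / (α + 1)) := by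
      rw [ht, ← Real.rpow_mul hε.le, hexp]
      congr 1
      ring
    have hpow : (⌈t⌉₊ : ℝ) ^ (-α) ≤ t ^ (-α) :=
      Real.rpow_le_rpow_of_nonpos htpos hle (by linarith)
    have hE : 0 ≤ ε ^ (1 - 1 / (α + 1)) := by positivity
    calc x ≤ ⌈t⌉₊ * (a * ε) + b * (⌈t⌉₊ : ℝ) ^ (-α) := h _ hn
      _ ≤ 2 * t * (a * ε) + b * t ^ (-α) := by gcongr
      _ = (2 * a + b) * ε ^ (1 - 1 / (α + 1)) := by rw [htα, ← htε]; ring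
      _ ≤ (2 * a + b + d) * ε ^ (1 - 1 / (α + 1)) :=
          mul_le_mul_of_nonneg_right (by linarith) hE
  · have hE : 1 ≤ ε ^ (1 - 1 / (α + 1)) := Real.one_le_rpow h1 (by rw [hexp]; exact hpos.le)
    calc x ≤ d * 1 := by linarith
      _ ≤ (2 * a + b + d) * ε ^ (1 - 1 / (α + 1)) := by gcongr; linarith

/-- The displacement of a point under `n` iterates of an operator is at most `n` times a common
bound for the iterates of its displacement under one step. -/
theorem sublinear_sub_pow_apply_le {E : Type*} [AddCommGroup E] [Module ℝ E] {N : E → ℝ}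
    (h0 : N 0 = 0) (hadd : ∀ f g, N (f + g) ≤ N f + N g) (L : E →ₗ[ℝ] E) (f : E) {c : ℝ}
    (hc : ∀ k : ℕ, N ((L ^ k) (f - L f)) ≤ c) (n : ℕ) :
    N (f - (L ^ n) f) ≤ n * c := by
  induction n with
  | zero => simp [h0]
  | succ n ih =>
    have hsplit : f - (L ^ (n + 1)) f = (f - (L ^ n) f) + (L ^ n) (f - L f) := by
      rw [pow_succ, Module.End.mul_apply, map_sub]
      abel
    rw [hsplit]
    push_cast
    linarith [hadd (f - (L ^ n) f) ((L ^ n) (f - L f)), hc n]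

/-- **Hölder statistical stability for power-law convergence to equilibrium**
(Remark 2.5 of the paper).  If `L0` has convergence to equilibrium with speed
`φ(x) = C x^{-α}`, then there is a constant `K1`, depending only on `Mt, Ct, C, α`
(and in particular not on the distance `ε` between the operators), such that
`nw (f1 - f0) ≤ K1 * ε ^ (1 - 1/(α+1)) = K1 * ε ^ (α/(α+1))`. -/
theorem holder_stability_power_law
    {X : Type*} [MetricSpace X] [MeasurableSpace X]
    (Mt Ct C α : ℝ) (hMt : 0 ≤ Mt) (hCt : 0 ≤ Ct) (hC : 0 < C) (hα : 0 < α) :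
    ∃ K1 : ℝ,
      ∀ (Bs Bw : Submodule ℝ (MeasureTheory.SignedMeasure X)), Bs ≤ Bw →
      ∀ ns nw : MeasureTheory.SignedMeasure X → ℝ,
      ns 0 = 0 → (∀ f, 0 ≤ ns f) →
      (∀ f g, ns (f + g) ≤ ns f + ns g) → (∀ (c : ℝ) f, ns (c • f) = |c| * ns f) →
      nw 0 = 0 → (∀ f, 0 ≤ nw f) →
      (∀ f g, nw (f + g) ≤ nw f + nw g) → (∀ (c : ℝ) f, nw (c • f) = |c| * nw f) →
      (∀ f ∈ Bs, nw f ≤ ns f) →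
      ∀ L0 L1 : MeasureTheory.SignedMeasure X →ₗ[ℝ] MeasureTheory.SignedMeasure X,
      (∀ f ∈ Bs, L0 f ∈ Bs) → (∀ f ∈ Bw, L0 f ∈ Bw) →
      (∀ f ∈ Bs, L1 f ∈ Bs) → (∀ f ∈ Bw, L1 f ∈ Bw) →
      ∀ f0 f1 : MeasureTheory.SignedMeasure X, f0 ∈ Bs → f1 ∈ Bs →
      (∀ E : Set X, MeasurableSet E → 0 ≤ f0 E) → f0 Set.univ = 1 →
      (∀ E : Set X, MeasurableSet E → 0 ≤ f1 E) → f1 Set.univ = 1 →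
      L0 f0 = f0 → L1 f1 = f1 →
      -- power-law convergence to equilibrium: `φ(x) = C x^{-α}`
      (∀ n : ℕ, 0 < n → ∀ g ∈ Bs, g Set.univ = 0 →
        nw ((L0 ^ n) g) ≤ C * (n : ℝ) ^ (-α) * ns g) →
      -- control of the strong norms of the invariant measures
      max (ns f0) (ns f1) ≤ Mt →
      -- bounded iterates in the weak norm
      (∀ n : ℕ, ∀ g ∈ Bw, nw ((L0 ^ n) g) ≤ Ct * nw g) →
      -- `ε` bounds the strong-to-weak distance of the operators
      ∀ ε : ℝ, 0 ≤ ε → (∀ f ∈ Bs, ns f ≤ 1 → nw (L1 f - L0 f) ≤ ε) →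
      nw (f1 - f0) ≤ K1 * ε ^ (1 - 1 / (α + 1)) := by
  refine ⟨2 * (Ct * (Mt + 1)) + C * (2 * Mt) + 2 * Mt, ?_⟩
  intro Bs Bw hB ns nw _ _ ns_add ns_smul nw_zero _ nw_add nw_smul hle L0 L1 hL0s _ _ _
    f0 f1 hf0 hf1 _ hf0u _ hf1u hfix0 hfix1 hconv hM hiter ε hε hdist
  have hsub : f1 - f0 ∈ Bs := Bs.sub_mem hf1 hf0
  have hns : ns (f1 - f0) ≤ 2 * Mt := by
    have h := ns_add f1 ((-1 : ℝ) • f0)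
    have hneg : f1 + (-1 : ℝ) • f0 = f1 - f0 :=
      (congrArg (f1 + ·) (neg_one_smul ℝ f0)).trans (sub_eq_add_neg f1 f0).symm
    rw [ns_smul, hneg, abs_neg, abs_one, one_mul] at h
    linarith [le_max_left (ns f0) (ns f1), le_max_right (ns f0) (ns f1)]
  have hM1 : 0 < Mt + 1 := by linarith
  have hstep : nw (f1 - L0 f1) ≤ (Mt + 1) * ε := by
    have h := hdist ((Mt + 1)⁻¹ • f1) (Bs.smul_mem _ hf1) (by
      rw [ns_smul, abs_of_pos (inv_pos.mpr hM1), inv_mul_le_iff₀ hM1]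
      linarith [le_max_right (ns f0) (ns f1)])
    have hsmul : L1 ((Mt + 1)⁻¹ • f1) - L0 ((Mt + 1)⁻¹ • f1) = (Mt + 1)⁻¹ • (L1 f1 - L0 f1) := by
      rw [map_smul, map_smul]
      exact (smul_sub _ _ _).symm
    rwa [hsmul, nw_smul, hfix1, abs_of_pos (inv_pos.mpr hM1),
      inv_mul_le_iff₀ hM1] at h
  have hdrift := sublinear_sub_pow_apply_le nw_zero nw_add L0 f1 (c := Ct * (Mt + 1) * ε)
    fun k => (hiter k _ (hB (Bs.sub_mem hf1 (hL0s _ hf1)))).trans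
      ((mul_le_mul_of_nonneg_left hstep hCt).trans_eq (mul_assoc _ _ _).symm)
  have hfix (n : ℕ) : (L0 ^ n) f0 = f0 := by
    rw [Module.End.pow_apply]
    exact Function.iterate_fixed hfix0 n
  refine le_mul_rpow_of_forall_nat_le (by positivity) (by positivity) (by positivity) hα hε
    ((hle _ hsub).trans hns) fun n hn => ?_
  have hsplit : f1 - f0 = (f1 - (L0 ^ n) f1) + (L0 ^ n) (f1 - f0) := by
    rw [map_sub, hfix]
    abel
  have hcn : nw ((L0 ^ n) (f1 - f0)) ≤ C * (2 * Mt) * (n : ℝ) ^ (-α) :=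
    calc nw ((L0 ^ n) (f1 - f0)) ≤ C * (n : ℝ) ^ (-α) * ns (f1 - f0) :=
          hconv n hn _ hsub (by simp [hf0u, hf1u])
      _ ≤ C * (n : ℝ) ^ (-α) * (2 * Mt) := by gcongr
      _ = C * (2 * Mt) * (n : ℝ) ^ (-α) := by ring
  calc nw (f1 - f0) ≤ nw (f1 - (L0 ^ n) f1) + nw ((L0 ^ n) (f1 - f0)) := by
        conv_lhs => rw [hsplit]
        exact nw_add _ _
    _ ≤ _ := add_le_add (hdrift n) hcn
end

section
/- Let θ = Σ_{i=1}^∞ 2^{−2^{2i}} and F_0(x,y) = (T_0(x), G_0(x,y)) on [0,1]×T^1 with T_0(x) = 2x mod 1 and G_0(x,y) = y + θ χ_{[1/2,1]}(x), and let μ_0 be the Lebesgue measure (invariant for F_0). Then there exist a sequence δ_j > 0 with δ_j → 0, maps F̂_{δ_j}(x,y) = (T_0(x), Ĝ_{δ_j}(x,y)) satisfying Sk1–Sk3 with ||Ĝ_{δ_j} − G_0||_∞ ≤ 2δ_j, invariant probability measures μ_j ∈ L¹ of F̂_{δ_j}, an observable ψ : [0,1]×T^1 → ℝ with derivative in L²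 (one can take ψ(x,y) = Σ_{i=1}^∞ (2^{2^{2i}})^{−2} cos(2^{2^{2i}} · 2π y)), and a constant C > 0, such that |∫ ψ dμ_0 − ∫ ψ dμ_j| ≥ C √(δ_j) for all j. -/
open MeasureTheory Metric Set Filter

/-- Wasserstein–Kantorovich-like distance between two (positive) measures:
`sup { |∫ g dμ − ∫ g dν| : Lip(g) ≤ 1, ‖g‖_∞ ≤ 1 }`. -/
noncomputable def wDist {M : Type*} [MetricSpace M] [MeasurableSpace M]
    (μ ν : Measure M) : ℝ :=
  ⨆ g : {g : M → ℝ // LipschitzWith 1 g ∧ ∀ x, |g x| ≤ 1},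
    |(∫ x, g.1 x ∂μ) - ∫ x, g.1 x ∂ν|

/-- The `W1` norm of a positive measure. -/
noncomputable def wNorm {M : Type*} [MetricSpace M] [MeasurableSpace M] (μ : Measure M) : ℝ :=
  wDist μ 0

/-- `leaf` is the family of leafwise restrictions `μ|_γ` of `μ` given by the Rokhlin
disintegration of `μ` along the leaves `{γ} × M`, `γ ∈ [0,1]`. -/
def IsLeafFamily {M : Type*} [MeasurableSpace M]
    (μ : Measure (ℝ × M)) (leaf : ℝ → Measure M) : Prop :=
  ∀ E : Set (ℝ × M), MeasurableSet E →
    μ E = ∫⁻ γ in Icc (0:ℝ) 1, leaf γ (Prod.mk γ ⁻¹' E)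

/-- The anisotropic `"1"` norm: `∫_0^1 ‖μ|_γ‖_{W1} dγ`. -/
noncomputable def nrmOne {M : Type*} [MetricSpace M] [MeasurableSpace M]
    (leaf : ℝ → Measure M) : ℝ :=
  ∫ γ in Icc (0:ℝ) 1, wNorm (leaf γ)

/-- The `"1"` norm of the difference of two positive measures, computed leafwise. -/
noncomputable def nrmOneDiff {M : Type*} [MetricSpace M] [MeasurableSpace M]
    (leaf1 leaf2 : ℝ → Measure M) : ℝ :=
  ∫ γ in Icc (0:ℝ) 1, wDist (leaf1 γ) (leaf2 γ)

/-- `osc(μ, x, r) = esssup_{γ₁,γ₂ ∈ B(x,r) ∩ [0,1]} ‖μ|_{γ₁} − μ|_{γ₂}‖_{W1}`. -/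
noncomputable def oscLeaf {M : Type*} [MetricSpace M] [MeasurableSpace M]
    (leaf : ℝ → Measure M) (x r : ℝ) : ℝ :=
  essSup (fun pq : ℝ × ℝ => wDist (leaf pq.1) (leaf pq.2))
    ((volume.restrict (ball x r ∩ Icc 0 1)).prod (volume.restrict (ball x r ∩ Icc 0 1)))

/-- `var_p(μ) = sup_{0 < r ≤ A} ∫_0^1 r^{-p} osc(μ,x,r) dx`. -/
noncomputable def varLeaf {M : Type*} [MetricSpace M] [MeasurableSpace M]
    (p A : ℝ) (leaf : ℝ → Measure M) : ℝ :=
  ⨆ r : {r : ℝ // 0 < r ∧ r ≤ A},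
    ∫ x in Icc (0:ℝ) 1, (r : ℝ) ^ (-p) * oscLeaf leaf x r

/-- Membership in `p-BV` (finiteness of the `p-BV` norm). -/
def InPBV {M : Type*} [MetricSpace M] [MeasurableSpace M] (p A : ℝ)
    (leaf : ℝ → Measure M) : Prop :=
  IntegrableOn (fun γ => wNorm (leaf γ)) (Icc (0:ℝ) 1) ∧
  BddAbove (Set.range fun r : {r : ℝ // 0 < r ∧ r ≤ A} =>
    ∫ x in Icc (0:ℝ) 1, (r : ℝ) ^ (-p) * oscLeaf leaf x r)
/-- The skew product map `F(x,y) = (T x, G x y)` on `ℝ × M`. -/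
def Fmap {M : Type*} (T : ℝ → ℝ) (G : ℝ → M → M) : ℝ × M → ℝ × M :=
  fun z => (T z.1, G z.1 z.2)

/-- The skew product `F = (T, G)` satisfies the assumptions `Sk1, Sk2, Sk3`:
`T` is piecewise expanding with `q` onto branches on the intervals `P i`,
with expansion `1/lam`, inverse branches `Tinv i`, derivative `T'`,
Hölder distortion constant `Ch` (exponent `xi`); `G` is `alpha`-Lipschitz in the fibers
with `lam ^ xi * alpha < 1`; and the `Sk3` oscillation bound holds with constants `H, A, p`. -/
def SkewSatisfies {M : Type*} [MetricSpace M] (T : ℝ → ℝ) (G : ℝ → M → M)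
    (q : ℕ) (P : Fin q → Set ℝ) (Tinv : Fin q → ℝ → ℝ) (T' : ℝ → ℝ)
    (lam xi alpha Ch A H p : ℝ) : Prop :=
  0 < q ∧ 0 < lam ∧ lam < 1 ∧ 0 < xi ∧ xi ≤ 1 ∧ 0 ≤ alpha ∧ lam ^ xi * alpha < 1 ∧
  0 ≤ Ch ∧ 0 < A ∧ 0 ≤ H ∧ 0 < p ∧ p ≤ xi ∧
  -- Sk1: the `P i` are intervals partitioning `[0,1]`
  (∀ i, (P i).OrdConnected ∧ P i ⊆ Icc (0:ℝ) 1) ∧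
  (∀ x ∈ Ico (0:ℝ) 1, ∃! i, x ∈ P i) ∧
  -- Sk1: differentiable branches, expansion `inf |T'| ≥ 1/lam`
  (∀ i, ∀ x ∈ P i, HasDerivWithinAt T (T' x) (P i) x) ∧
  (∀ i, ∀ x ∈ P i, 1 ≤ lam * |T' x|) ∧
  -- Sk1: onto branches, with inverse branches `Tinv i`
  (∀ i, ∀ γ ∈ Ico (0:ℝ) 1, Tinv i γ ∈ P i ∧ T (Tinv i γ) = γ) ∧
  -- Sk1: Hölder distortion
  (∀ i, ∀ γ1 ∈ Ico (0:ℝ) 1, ∀ γ2 ∈ Ico (0:ℝ) 1,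
    abs (1 / |T' (Tinv i γ1)| - 1 / |T' (Tinv i γ2)|) ≤ Ch * |γ1 - γ2| ^ xi) ∧
  -- Sk2: domination on the fibers
  (∀ x ∈ Icc (0:ℝ) 1, ∀ y1 y2 : M, dist (G x y1) (G x y2) ≤ alpha * dist y1 y2) ∧
  -- Sk3
  (∀ r : ℝ, 0 < r → r ≤ A →
    (∫ x in Icc (0:ℝ) 1,
      ⨆ z : M × (ball x r ∩ Icc (0:ℝ) 1 : Set ℝ) × (ball x r ∩ Icc (0:ℝ) 1 : Set ℝ),
        dist (G z.2.1.1 z.1) (G z.2.2.1 z.1)) ≤ H * r ^ p)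

/-- The unit-interval fractional part of doubling preserves Lebesgue measure. -/
theorem measurePreserving_fract_two_mul :
    MeasurePreserving (fun x : ℝ => Int.fract (2 * x))
      (volume.restrict (Icc (0:ℝ) 1)) (volume.restrict (Icc (0:ℝ) 1)) := by
  rw [← restrict_Ioc_eq_restrict_Icc]
  set r := (volume.restrict (Ioc (0:ℝ) 1) : Measure ℝ) with hr
  let φ : UnitAddCircle → ℝ := fun y => (AddCircle.equivIco (1:ℝ) 0 y : ℝ)
  have hφ : Measurable φ :=
    measurable_subtype_coe.comp (AddCircle.measurableEquivIco (1:ℝ) 0).measurable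
  have hφmk : ∀ x : ℝ, φ (x : UnitAddCircle) = Int.fract x := fun x => by
    simp [φ, AddCircle.coe_equivIco_mk_apply]
  have hmk : MeasurePreserving ((↑) : ℝ → UnitAddCircle) r volume := by
    simpa [hr] using UnitAddCircle.measurePreserving_mk 0
  have hφr : Measure.map φ volume = r := by
    rw [← hmk.map_eq, Measure.map_map hφ hmk.measurable]
    have : (φ ∘ ((↑) : ℝ → UnitAddCircle)) =ᵐ[r] id := by
      have h1 : ∀ᵐ x : ℝ ∂r, x ≠ 1 :=
        ae_restrict_of_ae (by simp [ae_iff])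
      filter_upwards [ae_restrict_mem measurableSet_Ioc, h1] with x hx hx1
      simp only [Function.comp_apply, hφmk, id]
      exact Int.fract_eq_self.2 ⟨hx.1.le, lt_of_le_of_ne hx.2 hx1⟩
    rw [Measure.map_congr this, Measure.map_id]
  have h2 := Measure.measurePreserving_zsmul (volume : Measure UnitAddCircle) (n := 2) (by norm_num)
  have h3 := (MeasurePreserving.mk hφ hφr).comp (h2.comp hmk)
  have hf : (fun x : ℝ => Int.fract (2 * x)) =
      φ ∘ (fun y => (2 : ℤ) • y) ∘ ((↑) : ℝ → UnitAddCircle) := by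
    funext x
    simp only [Function.comp_apply]
    rw [← hφmk, ← AddCircle.coe_zsmul]
    simp
  rw [hf]
  exact h3

/-- The uniform measure on the multiples `0, a, …, (n - 1) • a`. -/
noncomputable def uniformMultiples {G : Type*} [AddMonoid G] [MeasurableSpace G] (n : ℕ) (a : G) :
    Measure G :=
  (n : ENNReal)⁻¹ • ∑ k ∈ Finset.range n, Measure.dirac (k • a)

theorem isProbabilityMeasure_uniformMultiples {G : Type*} [AddMonoid G] [MeasurableSpace G]
    {n : ℕ} (hn : n ≠ 0) (a : G) : IsProbabilityMeasure (uniformMultiples n a) := by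
  constructor
  simp [uniformMultiples, ENNReal.inv_mul_cancel, hn]

theorem map_add_uniformMultiples {G : Type*} [AddCommGroup G] [MeasurableSpace G]
    [MeasurableAdd G] {n : ℕ} {a : G} (ha : n • a = 0) :
    (uniformMultiples n a).map (a + ·) = uniformMultiples n a := by
  have hm : Measurable (a + · : G → G) := measurable_const_add a
  rw [uniformMultiples, Measure.map_smul, ← Measure.mapₗ_apply_of_measurable hm, map_sum]
  congr 1
  simp only [Measure.mapₗ_apply_of_measurable hm, Measure.map_dirac' hm, ← succ_nsmul']
  cases n with
  | zero => simp
  | succ n => rw [Finset.sum_range_succ, Finset.sum_range_succ', ha, zero_nsmul]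

theorem map_add_nsmul_uniformMultiples {G : Type*} [AddCommGroup G] [MeasurableSpace G]
    [MeasurableAdd G] {n : ℕ} {a : G} (ha : n • a = 0) (m : ℕ) :
    (uniformMultiples n a).map (m • a + ·) = uniformMultiples n a := by
  induction m with
  | zero => simp
  | succ m ih =>
    have : (fun x : G => (m + 1) • a + x) = (a + ·) ∘ (m • a + ·) := by
      funext x
      simp only [Function.comp_apply, succ_nsmul']
      abel
    rw [this, ← Measure.map_map (measurable_const_add _) (measurable_const_add _), ih,
      map_add_uniformMultiples ha]

theorem integral_uniformMultiples {G : Type*} [AddMonoid G] [MeasurableSpace G]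
    [MeasurableSingletonClass G] (n : ℕ) (a : G) (f : G → ℝ) :
    ∫ x, f x ∂(uniformMultiples n a) = (n : ℝ)⁻¹ * ∑ k ∈ Finset.range n, f (k • a) := by
  rw [uniformMultiples, integral_smul_measure, integral_finsetSum_measure]
  · simp
  · intro k _
    exact integrable_dirac (by simp)

theorem inv_mul_sum_bernoulliFun_two {n : ℕ} (hn : n ≠ 0) :
    (n : ℝ)⁻¹ * ∑ k ∈ Finset.range n, bernoulliFun 2 ((k : ℝ) / n) = 1 / (6 * n ^ 2) := by
  have h := bernoulliFun_mul 2 hn 0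
  have hn' : (n : ℝ) ≠ 0 := by exact_mod_cast hn
  simp only [mul_zero, zero_add, bernoulliFun_two (0 : ℝ)] at h
  field_simp at h ⊢
  linarith

theorem integral_periodizedBernoulli_uniformMultiples {n : ℕ} (hn : n ≠ 0) :
    ∫ y, periodizedBernoulli 2 y ∂(uniformMultiples n (((n : ℝ)⁻¹ : ℝ) : UnitAddCircle)) =
      1 / (6 * n ^ 2) := by
  rw [integral_uniformMultiples, ← inv_mul_sum_bernoulliFun_two hn]
  congr 1
  refine Finset.sum_congr rfl fun k hk => ?_
  have hk' : (k : ℝ) < n := by exact_mod_cast Finset.mem_range.1 hk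
  have hn' : (0 : ℝ) < n := by positivity
  rw [← AddCircle.coe_nsmul, nsmul_eq_mul, ← div_eq_mul_inv, periodizedBernoulli,
    AddCircle.liftIco_coe_apply]
  refine ⟨by positivity, ?_⟩
  rw [zero_add, div_lt_one hn']
  exact hk'

theorem integral_periodizedBernoulli_two :
    ∫ y : UnitAddCircle, periodizedBernoulli 2 y = 0 := by
  have h := fourierCoeff_bernoulli_eq (k := 2) (by norm_num) 0
  have hv : (volume : Measure UnitAddCircle) = AddCircle.haarAddCircle := by
    simp [AddCircle.volume_eq_smul_haarAddCircle]
  rw [fourierCoeff] at h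
  simp only [neg_zero, fourier_zero, one_smul, Function.comp_apply] at h
  rw [← hv, integral_complex_ofReal] at h
  simpa using h

theorem summable_fourierCoeff_periodizedBernoulli_two :
    Summable (fun n : ℤ => (n : ℝ) ^ 2 *
      ‖fourierCoeff (fun y : UnitAddCircle => (periodizedBernoulli 2 y : ℂ)) n‖ ^ 2) := by
  have hs : Summable (fun n : ℤ => (1 / (4 * Real.pi ^ 4)) * (1 / (n : ℝ) ^ 2)) :=
    (Real.summable_one_div_int_pow.2 (by norm_num)).mul_left _
  refine hs.congr fun n => ?_
  have h := fourierCoeff_bernoulli_eq (k := 2) (by norm_num) n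
  simp only [Function.comp_def] at h
  rw [h]
  simp only [norm_div, norm_neg, norm_pow, norm_mul, Complex.norm_I, Complex.norm_real,
    Complex.norm_intCast, Real.norm_eq_abs, abs_of_pos Real.pi_pos]
  simp only [Nat.factorial, mul_pow, sq_abs]
  rcases eq_or_ne n 0 with rfl | hn
  · simp
  · have : (n : ℝ) ≠ 0 := by exact_mod_cast hn
    have := Real.pi_ne_zero
    norm_num
    field_simp
    norm_num

/-- The scales `2 ^ 2 ^ (2 i)`, `i ≥ 1`, indexed from zero. -/
def liouvilleScale (i : ℕ) : ℕ := 2 ^ (2 ^ (2 * (i + 1)))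

theorem liouvilleScale_ne_zero (i : ℕ) : liouvilleScale i ≠ 0 := by simp [liouvilleScale]

theorem liouvilleScale_succ (i : ℕ) : liouvilleScale (i + 1) = liouvilleScale i ^ 4 := by
  simp only [liouvilleScale, ← pow_mul]
  congr 1
  ring

theorem two_mul_liouvilleScale_le (i : ℕ) : 2 * liouvilleScale i ≤ liouvilleScale (i + 1) := by
  rw [liouvilleScale_succ]
  have h : 2 ≤ liouvilleScale i := Nat.le_self_pow (by positivity) 2
  calc 2 * liouvilleScale i ≤ liouvilleScale i * liouvilleScale i := Nat.mul_le_mul_right _ h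
    _ ≤ liouvilleScale i ^ 4 := by
      rw [← sq]; exact Nat.pow_le_pow_right (by omega) (by norm_num)

theorem inv_liouvilleScale_add_le (j i : ℕ) :
    (liouvilleScale (i + j) : ℝ)⁻¹ ≤ (liouvilleScale j : ℝ)⁻¹ * (1 / 2) ^ i := by
  induction i with
  | zero => simp
  | succ i ih =>
    have h : (2 : ℝ) * liouvilleScale (i + j) ≤ liouvilleScale (i + j + 1) := by
      exact_mod_cast two_mul_liouvilleScale_le (i + j)
    have hp : (0 : ℝ) < liouvilleScale (i + j) := by
      exact_mod_cast Nat.pos_of_ne_zero (liouvilleScale_ne_zero _)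
    calc (liouvilleScale (i + 1 + j) : ℝ)⁻¹ ≤ (2 * (liouvilleScale (i + j) : ℝ))⁻¹ := by
          rw [add_right_comm]
          exact inv_anti₀ (by positivity) h
      _ = (liouvilleScale (i + j) : ℝ)⁻¹ * (1 / 2) := by rw [mul_inv]; ring
      _ ≤ _ := by rw [pow_succ, ← mul_assoc]; gcongr

theorem summable_inv_liouvilleScale : Summable fun i => (liouvilleScale i : ℝ)⁻¹ := by
  refine Summable.of_nonneg_of_le (fun i => by positivity) (inv_liouvilleScale_add_le 0)
    (Summable.mul_left _ ?_)
  exact summable_geometric_of_lt_one (by norm_num) (by norm_num)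

theorem abs_sum_sub_tsum_inv_liouvilleScale_le (j : ℕ) :
    |∑ i ∈ Finset.range j, (liouvilleScale i : ℝ)⁻¹ - ∑' i, (liouvilleScale i : ℝ)⁻¹| ≤
      2 * (liouvilleScale j : ℝ)⁻¹ := by
  have hs := summable_inv_liouvilleScale
  rw [← hs.sum_add_tsum_nat_add j, sub_add_cancel_left, abs_neg, abs_of_nonneg
    (tsum_nonneg fun i => by positivity)]
  have hg : Summable fun i : ℕ => (1 / 2 : ℝ) ^ i :=
    summable_geometric_of_lt_one (by norm_num) (by norm_num)
  refine (((summable_nat_add_iff j).2 hs).tsum_le_tsum (inv_liouvilleScale_add_le j)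
    (hg.mul_left _)).trans ?_
  rw [tsum_mul_left, tsum_geometric_two, mul_comm]

theorem exists_sum_inv_liouvilleScale_eq (j : ℕ) :
    ∃ m : ℕ, ∑ i ∈ Finset.range (j + 1), (liouvilleScale i : ℝ)⁻¹ =
      m * (liouvilleScale j : ℝ)⁻¹ := by
  induction j with
  | zero => exact ⟨1, by simp⟩
  | succ j ih =>
    obtain ⟨m, hm⟩ := ih
    refine ⟨m * liouvilleScale j ^ 3 + 1, ?_⟩
    have : (liouvilleScale j : ℝ) ≠ 0 := by exact_mod_cast liouvilleScale_ne_zero j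
    rw [Finset.sum_range_succ, hm, liouvilleScale_succ]
    push_cast
    field_simp

theorem doubling_rotation_skewSatisfies (t : AddCircle (1:ℝ)) :
    SkewSatisfies (fun x => Int.fract (2 * x))
      (fun x y => y + Set.indicator (Icc (1/2 : ℝ) 1) (fun _ => t) x)
      2 (fun i => Ico ((i : ℝ) / 2) (((i : ℝ) + 1) / 2)) (fun i γ => (γ + i) / 2) (fun _ => 2)
      (1 / 2) 1 1 0 1 1 1 := by
  have hmem : ∀ i : Fin 2, ∀ x ∈ Ico ((i : ℝ) / 2) (((i : ℝ) + 1) / 2),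
      Int.fract (2 * x) = 2 * x - i := by
    intro i x hx
    have : (⌊2 * x⌋ : ℤ) = ((i : ℕ) : ℤ) := by
      rw [Int.floor_eq_iff]
      push_cast
      constructor <;> linarith [hx.1, hx.2]
    rw [Int.fract, this]
    push_cast
    rfl
  refine ⟨by norm_num, by norm_num, by norm_num, by norm_num, by norm_num, by norm_num,
    by norm_num, le_rfl, by norm_num, by norm_num, by norm_num, le_rfl, ?_, ?_, ?_, ?_, ?_, ?_,
    ?_, ?_⟩
  · intro i
    refine ⟨ordConnected_Ico, fun x hx => ?_⟩
    have h0 : (0 : ℝ) ≤ (i : ℕ) := Nat.cast_nonneg _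
    have h1 : ((i : ℕ) : ℝ) ≤ 1 := by exact_mod_cast Nat.lt_succ_iff.1 i.2
    constructor <;> linarith [hx.1, hx.2]
  · intro x hx
    rcases lt_or_ge x (1 / 2) with h | h
    · refine ⟨0, by constructor <;> simp <;> linarith [hx.1], fun i hi => ?_⟩
      fin_cases i
      · rfl
      · have := hi.1
        norm_num at this h
        linarith
    · refine ⟨1, by constructor <;> simp <;> linarith [hx.2], fun i hi => ?_⟩
      fin_cases i
      · have := hi.2
        norm_num at this h
        linarith
      · rfl
  · intro i x hx
    have h : HasDerivWithinAt (fun x : ℝ => 2 * x - i) 2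
        (Ico ((i : ℝ) / 2) (((i : ℝ) + 1) / 2)) x := by
      simpa using (((hasDerivAt_id x).const_mul 2).sub_const (i : ℝ)).hasDerivWithinAt
    exact h.congr (hmem i) (hmem i x hx)
  · intro i x _
    norm_num
  · intro i γ hγ
    have h : (γ + i) / 2 ∈ Ico ((i : ℝ) / 2) (((i : ℝ) + 1) / 2) := by
      constructor <;> linarith [hγ.1, hγ.2]
    refine ⟨h, ?_⟩
    simp only [hmem i _ h]
    ring
  · intro i γ₁ _ γ₂ _
    simp
  · intro x _ y₁ y₂
    simp
  · intro r hr _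
    rw [Real.rpow_one, one_mul]
    have hle : ∀ x : ℝ,
        (⨆ z : AddCircle (1:ℝ) × (ball x r ∩ Icc (0:ℝ) 1 : Set ℝ) ×
            (ball x r ∩ Icc (0:ℝ) 1 : Set ℝ),
          dist (z.1 + Set.indicator (Icc (1/2 : ℝ) 1) (fun _ => t) z.2.1.1)
            (z.1 + Set.indicator (Icc (1/2 : ℝ) 1) (fun _ => t) z.2.2.1)) ≤
        (ball (1/2 : ℝ) r).indicator (fun _ => (1 / 2 : ℝ)) x := by
      intro x
      refine Real.iSup_le (fun z => ?_) (indicator_nonneg (fun _ _ => by norm_num) x)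
      obtain ⟨y, ⟨u, hu⟩, ⟨v, hv⟩⟩ := z
      by_cases hx : x ∈ ball (1/2 : ℝ) r
      · rw [indicator_of_mem hx, dist_eq_norm]
        simpa using AddCircle.norm_le_half_period (1:ℝ) one_ne_zero
      · rw [indicator_of_notMem hx]
        have huv : u ∈ Icc (1/2 : ℝ) 1 ↔ v ∈ Icc (1/2 : ℝ) 1 := by
          simp only [mem_ball, Real.dist_eq, not_lt, mem_inter_iff, mem_Icc] at *
          obtain ⟨hu, hu0, hu1⟩ := hu
          obtain ⟨hv, hv0, hv1⟩ := hv
          rw [abs_lt] at hu hv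
          rcases le_abs.1 hx with h | h
          · exact ⟨fun _ => ⟨by linarith, hv1⟩, fun _ => ⟨by linarith, hu1⟩⟩
          · exact ⟨fun h' => by linarith [h'.1], fun h' => by linarith [h'.1]⟩
        have : Set.indicator (Icc (1/2 : ℝ) 1) (fun _ => t) u =
            Set.indicator (Icc (1/2 : ℝ) 1) (fun _ => t) v := by
          simp only [indicator, huv]
        rw [this, dist_self]
    have hi : Integrable ((ball (1/2 : ℝ) r).indicator (fun _ => (1 / 2 : ℝ))) :=
      (integrable_indicator_iff measurableSet_ball).2
        (integrableOn_const measure_ball_lt_top.ne)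
    have hnn : 0 ≤ (ball (1/2 : ℝ) r).indicator (fun _ => (1 / 2 : ℝ)) :=
      indicator_nonneg fun _ _ => by norm_num
    calc _ ≤ ∫ x in Icc (0:ℝ) 1, (ball (1/2 : ℝ) r).indicator (fun _ => (1 / 2 : ℝ)) x :=
          integral_mono_of_nonneg
            (Eventually.of_forall fun x => Real.iSup_nonneg fun _ => dist_nonneg)
            hi.integrableOn (Eventually.of_forall hle)
      _ ≤ ∫ x, (ball (1/2 : ℝ) r).indicator (fun _ => (1 / 2 : ℝ)) x :=
          setIntegral_le_integral hi (Eventually.of_forall hnn)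
      _ = r := by
          rw [integral_indicator measurableSet_ball, setIntegral_const, Measure.real,
            Real.volume_ball, ENNReal.toReal_ofReal (by linarith), smul_eq_mul]
          ring

/-- **Hölder behavior of the average of a regular observable** (Proposition 6.9 of the
paper).  Let `θ = Σ_{i≥1} 2^{−2^{2i}}` and `F_0(x,y) = (2x mod 1, y + θ χ_{[1/2,1]}(x))`
on `[0,1] × 𝕋¹`, preserving the Lebesgue measure `μ_0`.  There are `δ_j → 0`, `δ_j > 0`,
maps `F̂_j = (T_0, Ĝ_j)` satisfying `Sk1–Sk3` with `‖Ĝ_j − G_0‖_∞ ≤ 2δ_j`, invariant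
probability measures `μ_j ∈ L¹` of `F̂_j`, an observable `ψ(x,y) = h(y)` with derivative
in `L²` (encoded by `Σ n² |ĥ(n)|² < ∞`), and `C > 0`, with
`|∫ ψ dμ_0 − ∫ ψ dμ_j| ≥ C √δ_j` for all `j`. -/
theorem holder_behavior_observable :
    ∃ (δseq : ℕ → ℝ) (Ghat : ℕ → ℝ → AddCircle (1:ℝ) → AddCircle (1:ℝ))
      (μ : ℕ → Measure (ℝ × AddCircle (1:ℝ)))
      (leafμ : ℕ → ℝ → Measure (AddCircle (1:ℝ)))
      (h : AddCircle (1:ℝ) → ℝ) (C : ℝ),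
      (∀ j, 0 < δseq j) ∧ Tendsto δseq atTop (nhds 0) ∧
      -- each `F̂_j = (T_0, Ĝ_j)` satisfies `Sk1–Sk3`
      (∀ j, ∃ (q : ℕ) (P : Fin q → Set ℝ) (Tinv : Fin q → ℝ → ℝ) (T' : ℝ → ℝ)
          (lam xi alpha Ch A H p : ℝ),
        SkewSatisfies (fun x => Int.fract (2 * x)) (Ghat j) q P Tinv T'
          lam xi alpha Ch A H p) ∧
      -- `‖Ĝ_j − G_0‖_∞ ≤ 2 δ_j`, where `G_0 (x,y) = y + θ χ_{[1/2,1]}(x)` and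
      -- `θ = Σ_{i≥1} 2^{−2^{2i}}`
      (∀ j, ∀ x ∈ Icc (0:ℝ) 1, ∀ y : AddCircle (1:ℝ),
        dist (Ghat j x y)
          (y + Set.indicator (Icc (1/2 : ℝ) 1)
            (fun _ => ((∑' i : ℕ, ((2:ℝ) ^ (2 ^ (2 * (i + 1)) : ℕ))⁻¹ : ℝ) :
              AddCircle (1:ℝ))) x) ≤ 2 * δseq j) ∧
      -- the `μ_j` are invariant probability measures of `F̂_j` in `L¹`
      (∀ j, IsProbabilityMeasure (μ j) ∧
        (μ j).map (Fmap (fun x => Int.fract (2 * x)) (Ghat j)) = μ j ∧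
        IsLeafFamily (μ j) (leafμ j) ∧
        IntegrableOn (fun x => wNorm (leafμ j x)) (Icc (0:ℝ) 1)) ∧
      -- the observable `ψ(x,y) = h(y)` has derivative in `L²`
      Summable (fun n : ℤ => (n : ℝ) ^ 2 * ‖fourierCoeff (fun y => (h y : ℂ)) n‖ ^ 2) ∧
      0 < C ∧
      -- `|∫ ψ dμ_0 − ∫ ψ dμ_j| ≥ C √δ_j`
      (∀ j, C * Real.sqrt (δseq j) ≤
        |(∫ z, h z.2 ∂((volume.restrict (Icc (0:ℝ) 1)).prod
            (volume : Measure (AddCircle (1:ℝ))))) - ∫ z, h z.2 ∂(μ j)|) := by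
  have hN : ∀ j, (0 : ℝ) < liouvilleScale j := fun j => by
    exact_mod_cast Nat.pos_of_ne_zero (liouvilleScale_ne_zero j)
  let a : ℕ → UnitAddCircle := fun j => (((liouvilleScale j : ℝ)⁻¹ : ℝ) : UnitAddCircle)
  have ha : ∀ j, liouvilleScale j • a j = 0 := fun j => by
    rw [← AddCircle.coe_nsmul, nsmul_eq_mul, mul_inv_cancel₀ (hN j).ne']
    exact AddCircle.coe_period 1
  let t : ℕ → UnitAddCircle := fun j =>
    ((∑ i ∈ Finset.range (j + 1), (liouvilleScale i : ℝ)⁻¹ : ℝ) : UnitAddCircle)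
  have ht : ∀ j, ∃ m : ℕ, t j = m • a j := fun j => by
    obtain ⟨m, hm⟩ := exists_sum_inv_liouvilleScale_eq j
    refine ⟨m, ?_⟩
    rw [← AddCircle.coe_nsmul, nsmul_eq_mul, ← hm]
  let ν : ℕ → Measure UnitAddCircle := fun j => uniformMultiples (liouvilleScale j) (a j)
  have hν : ∀ j, IsProbabilityMeasure (ν j) := fun j =>
    isProbabilityMeasure_uniformMultiples (liouvilleScale_ne_zero j) _
  have hI : IsProbabilityMeasure (volume.restrict (Icc (0:ℝ) 1)) := ⟨by simp⟩
  refine ⟨fun j => (liouvilleScale (j + 1) : ℝ)⁻¹,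
    fun j x y => y + Set.indicator (Icc (1/2 : ℝ) 1) (fun _ => t j) x,
    fun j => (volume.restrict (Icc (0:ℝ) 1)).prod (ν j), fun j _ => ν j,
    periodizedBernoulli 2, 1 / 6, fun j => inv_pos.2 (hN _), ?_, ?_, ?_, ?_,
    summable_fourierCoeff_periodizedBernoulli_two, by norm_num, ?_⟩
  · exact (tendsto_add_atTop_iff_nat 1).2 summable_inv_liouvilleScale.tendsto_atTop_zero
  · exact fun j => ⟨_, _, _, _, _, _, _, _, _, _, _, doubling_rotation_skewSatisfies (t j)⟩
  · intro j x _ y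
    have hθ : (∑' i : ℕ, ((2:ℝ) ^ (2 ^ (2 * (i + 1)) : ℕ))⁻¹ : ℝ) =
        ∑' i, (liouvilleScale i : ℝ)⁻¹ := by
      simp [liouvilleScale]
    rw [hθ, dist_add_left]
    by_cases hx : x ∈ Icc (1/2 : ℝ) 1
    · rw [indicator_of_mem hx, indicator_of_mem hx, dist_eq_norm, ← AddCircle.coe_sub]
      exact (QuotientAddGroup.norm_mk_le_norm).trans (abs_sum_sub_tsum_inv_liouvilleScale_le (j + 1))
    · rw [indicator_of_notMem hx, indicator_of_notMem hx, dist_self]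
      exact mul_nonneg zero_le_two (inv_pos.2 (hN _)).le
  · intro j
    refine ⟨inferInstance, ?_, ?_, ?_⟩
    · refine (measurePreserving_fract_two_mul.skew_product (μc := ν j) (μd := ν j)
        (g := fun x y => y + Set.indicator (Icc (1/2 : ℝ) 1) (fun _ => t j) x) ?_ ?_).map_eq
      · exact measurable_snd.add
          ((measurable_const.indicator measurableSet_Icc).comp measurable_fst)
      · refine Eventually.of_forall fun x => ?_
        by_cases hx : x ∈ Icc (1/2 : ℝ) 1
        · obtain ⟨m, hm⟩ := ht j
          simp only [indicator_of_mem hx, hm, add_comm _ (m • a j)]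
          exact map_add_nsmul_uniformMultiples (ha j) m
        · simp only [indicator_of_notMem hx, add_zero, Measure.map_id']
    · exact fun E hE => Measure.prod_apply hE
    · exact integrableOn_const (by simp)
  · intro j
    rw [integral_fun_snd, integral_fun_snd, integral_periodizedBernoulli_two,
      integral_periodizedBernoulli_uniformMultiples (liouvilleScale_ne_zero j)]
    have hs : √((liouvilleScale (j + 1) : ℝ)⁻¹) = ((liouvilleScale j : ℝ) ^ 2)⁻¹ := by
      rw [liouvilleScale_succ, Real.sqrt_inv]
      push_cast
      rw [show (liouvilleScale j : ℝ) ^ 4 = ((liouvilleScale j : ℝ) ^ 2) ^ 2 by ring,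
        Real.sqrt_sq (by positivity)]
    rw [hs, smul_zero, zero_sub, abs_neg, probReal_univ, one_smul,
      abs_of_nonneg (by positivity)]
    apply le_of_eq
    field_simp
end

section
/- Let μ_0 = m ⊗ Leb be the Lebesgue measure on X = [0,1]×T^1, let k ≥ 1 and p be integers with gcd(p,k) = 1, let y_1 = 0, y_2, ..., y_k be the (periodic) orbit of 0 under the circle rotation y ↦ y + p/k (so {y_1,...,y_k} are k equally spaced points of T^1), and let μ = (1/k) Σ_{i=1}^k m ⊗ δ_{y_i}, where m is Lebesgue measure on [0,1] and δ_{y_i} the Dirac mass at y_i. Then ||μ_0 − μ||_{"1"} ≥ 1/(9k). -/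
open MeasureTheory Metric Set Filter

/-- Every competitor in the supremum defining `wDist` is bounded by the sum of total masses. -/
lemma bddAbove_range_wDist {M : Type*} [MetricSpace M] [MeasurableSpace M]
    (μ ν : Measure M) [IsFiniteMeasure μ] [IsFiniteMeasure ν] :
    BddAbove (Set.range fun g : {g : M → ℝ // LipschitzWith 1 g ∧ ∀ x, |g x| ≤ 1} =>
      |(∫ x, g.1 x ∂μ) - ∫ x, g.1 x ∂ν|) := by
  refine ⟨1 * μ.real univ + 1 * ν.real univ, ?_⟩
  rintro _ ⟨⟨g, -, hg⟩, rfl⟩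
  refine (abs_sub _ _).trans (add_le_add ?_ ?_) <;>
    exact norm_integral_le_of_norm_le_const (f := g) (.of_forall hg)

/-- Any admissible test function gives a lower bound for `wDist`. -/
lemma abs_integral_sub_le_wDist {M : Type*} [MetricSpace M] [MeasurableSpace M]
    (μ ν : Measure M) [IsFiniteMeasure μ] [IsFiniteMeasure ν] {g : M → ℝ}
    (hg : LipschitzWith 1 g) (hg1 : ∀ x, |g x| ≤ 1) :
    |(∫ x, g x ∂μ) - ∫ x, g x ∂ν| ≤ wDist μ ν :=
  le_ciSup (bddAbove_range_wDist μ ν) ⟨g, hg, hg1⟩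

lemma nrmOneDiff_const {M : Type*} [MetricSpace M] [MeasurableSpace M] (μ ν : Measure M) :
    nrmOneDiff (fun _ => μ) (fun _ => ν) = wDist μ ν := by
  simp [nrmOneDiff]

/-- The mean distance to `0` on the unit circle is at least `1 / 9` (it equals `1 / 4`). -/
lemma one_div_nine_le_integral_norm :
    (1 : ℝ) / 9 ≤ ∫ x : AddCircle (1 : ℝ), ‖x‖ := by
  rw [← AddCircle.intervalIntegral_preimage 1 (-(1 / 2))]
  have hc : Continuous fun x : ℝ => ‖(x : AddCircle (1 : ℝ))‖ :=
    continuous_norm.comp (AddCircle.continuous_mk' 1)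
  calc (1 : ℝ) / 9 ≤ ∫ x in (-(1 / 2) : ℝ)..(-(1 / 2) + 1), 2 * x ^ 2 := by
        rw [intervalIntegral.integral_const_mul, integral_pow]; norm_num
    _ ≤ _ := by
        refine intervalIntegral.integral_mono_on (by norm_num)
          (Continuous.intervalIntegrable (by fun_prop) _ _) (hc.intervalIntegrable _ _) ?_
        rintro x ⟨h1, h2⟩
        have hx : |x| ≤ 1 / 2 := abs_le.2 ⟨h1, by linarith⟩
        rw [(AddCircle.norm_coe_eq_abs_iff 1 one_ne_zero).2 (by simpa using hx), ← sq_abs]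
        nlinarith [abs_nonneg x]

/-- The normalized distance `‖k • x‖ / k` to the `k`-torsion points is `1`-Lipschitz. -/
lemma lipschitzWith_norm_nsmul_div {E : Type*} [SeminormedAddCommGroup E] {k : ℕ} (hk : 1 ≤ k) :
    LipschitzWith 1 fun x : E => ‖k • x‖ / k := by
  have hk0 : (0 : ℝ) < k := by exact_mod_cast hk
  refine LipschitzWith.of_dist_le_mul fun x y => ?_
  rw [Real.dist_eq, ← sub_div, abs_div, abs_of_pos hk0, div_le_iff₀ hk0, dist_eq_norm]
  calc |‖k • x‖ - ‖k • y‖| ≤ ‖k • x - k • y‖ := abs_norm_sub_norm_le _ _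
    _ = ‖k • (x - y)‖ := by rw [smul_sub]
    _ ≤ k * ‖x - y‖ := norm_nsmul_le
    _ = _ := by simp [mul_comm]

/-- **Distance between Lebesgue measure and the uniform measure on a periodic orbit**
(used in the proof of Proposition 6.8 of the paper).  Let `μ_0 = m ⊗ Leb` on
`[0,1] × 𝕋¹`, let `y_1 = 0, …, y_k` be the orbit of `0` under the rotation by `p/k`
(`gcd(p,k) = 1`), i.e. `k` equally spaced points, and `μ = (1/k) Σ_i m ⊗ δ_{y_i}`.
Then `‖μ_0 − μ‖_"1" ≥ 1/(9k)`.  Leafwise, `μ_0|_γ` is the Lebesgue (Haar) probability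
measure on `𝕋¹` and `μ|_γ = (1/k) Σ_i δ_{y_i}` for every `γ ∈ [0,1]`. -/
theorem lebesgue_vs_periodic_orbit_measure
    (k : ℕ) (hk : 1 ≤ k) (p : ℤ) (hpk : Int.gcd p (k : ℤ) = 1) :
    (1 : ℝ) / (9 * k) ≤
      nrmOneDiff (fun _ => (volume : Measure (AddCircle (1:ℝ))))
        (fun _ => ((k : ENNReal))⁻¹ • ∑ i ∈ Finset.range k,
          Measure.dirac ((((i : ℝ) * (p : ℝ) / (k : ℝ)) : ℝ) : AddCircle (1:ℝ))) := by
  have hk0 : (0 : ℝ) < k := by exact_mod_cast hk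
  have hk1 : (1 : ℝ) ≤ k := by exact_mod_cast hk
  have : IsFiniteMeasure (((k : ENNReal))⁻¹ • ∑ i ∈ Finset.range k,
      Measure.dirac ((((i : ℝ) * (p : ℝ) / (k : ℝ)) : ℝ) : AddCircle (1:ℝ))) :=
    Measure.smul_finite _ (by simp; omega)
  have hlip := lipschitzWith_norm_nsmul_div (E := AddCircle (1 : ℝ)) hk
  have hbound : ∀ x : AddCircle (1 : ℝ), |‖k • x‖ / k| ≤ 1 := by
    intro x
    rw [abs_of_nonneg (by positivity), div_le_one hk0]
    have := AddCircle.norm_le_half_period (1 : ℝ) (x := k • x) one_ne_zero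
    norm_num at this
    linarith
  have horbit : ∀ i : ℕ,
      ‖k • ((((i : ℝ) * (p : ℝ) / (k : ℝ)) : ℝ) : AddCircle (1:ℝ))‖ / k = 0 := by
    intro i
    have : k • ((((i : ℝ) * (p : ℝ) / (k : ℝ)) : ℝ) : AddCircle (1:ℝ)) = 0 := by
      rw [← AddCircle.coe_nsmul, AddCircle.coe_eq_zero_iff]
      refine ⟨i * p, ?_⟩
      push_cast [zsmul_eq_mul, nsmul_eq_mul]
      field_simp
    rw [this, norm_zero, zero_div]
  have hmp : MeasurePreserving (fun x : AddCircle (1 : ℝ) => k • x) volume volume := by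
    rcases hk.eq_or_lt with rfl | hlt
    · simpa only [one_smul] using! MeasurePreserving.id (volume : Measure (AddCircle (1 : ℝ)))
    · exact (AddCircle.ergodic_nsmul hlt).toMeasurePreserving
  rw [nrmOneDiff_const]
  refine le_trans ?_ (abs_integral_sub_le_wDist _ _ hlip hbound)
  rw [integral_smul_measure, integral_finsetSum_measure fun i _ =>
    (hlip.continuous.integrable_of_hasCompactSupport (HasCompactSupport.of_compactSpace _))]
  simp only [integral_dirac, horbit, Finset.sum_const_zero, smul_zero, sub_zero, integral_div]
  rw [← integral_map (f := fun y => ‖y‖) hmp.aemeasurable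
    continuous_norm.aestronglyMeasurable, hmp.map_eq]
  refine le_trans ?_ (le_abs_self _)
  rw [← div_div]
  gcongr
  exact one_div_nine_le_integral_norm
end
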